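/- Let n ≥ 2 be an integer, let V : ℝ^n → ℝ be a C^2 function, K > 0 and C_V ∈ ℝ constants such that V(x) − |∇V(x)|^2/(2K) + ΔV(x)/K − n ≤ C_V for almost every x ∈ ℝ^n, and suppose G_V = ∫_{ℝ^n} e^{-V(x)} dx < ∞. Let γ_V be the probability measure on ℝ^n with density G_V^{-1} e^{-V} with respect to Lebesgue measure. Then for every smooth compactly supported function h : ℝ^n → ℝ with ∫_{ℝ^n} h^2 dγ_V = 1 one has ∫_{ℝ^n} h^2 log h^2 dγ_V ≤ (2/K) ∫_{ℝ^n} |∇h|^2 dγ_V + log ( K^{n/2} G_V e^{C_V} / (2π)^{n/2} ), where h^2 log h^2 is interpreted as 0 where h vanishes. -/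

import Mathlib

open Real MeasureTheory Filter Topology

/-- The volume of the unit ball in `ℝ^n`: `ω_n = π^(n/2) / Γ(n/2 + 1)`. -/
noncomputable def ballVol (n : ℕ) : ℝ := Real.pi ^ ((n : ℝ) / 2) / Real.Gamma ((n : ℝ) / 2 + 1)

/-- The Laplacian of `V : ℝ^n → ℝ` at `x`: the trace of the second derivative,
i.e. the sum of the pure second partial derivatives. -/
noncomputable def lapl (n : ℕ) (V : EuclideanSpace ℝ (Fin n) → ℝ)
    (x : EuclideanSpace ℝ (Fin n)) : ℝ :=
  ∑ i : Fin n, iteratedFDeriv ℝ 2 V x ![EuclideanSpace.single i 1, EuclideanSpace.single i 1]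

theorem hasCompactSupport_sq {X : Type*} [TopologicalSpace X] {f : X → ℝ}
    (hf : HasCompactSupport f) : HasCompactSupport fun x => f x ^ 2 :=
  hf.comp_left (g := fun y : ℝ => y ^ 2) (zero_pow two_ne_zero)

theorem hasDerivAt_integral_Iic {g : ℝ → ℝ} (hg : Continuous g) (hi : Integrable g) (x : ℝ) :
    HasDerivAt (fun y => ∫ t in Set.Iic y, g t) (g x) x := by
  have h := (hg.integral_hasStrictDerivAt 0 x).hasDerivAt.const_add (∫ t in Set.Iic 0, g t)
  refine h.congr_of_eventuallyEq (Eventually.of_forall fun y => ?_)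
  have := intervalIntegral.integral_Iic_sub_Iic (hi.integrableOn (s := Set.Iic 0))
    (hi.integrableOn (s := Set.Iic y))
  simp only
  linarith

theorem continuous_gaussianPDFReal (v : NNReal) :
    Continuous (ProbabilityTheory.gaussianPDFReal 0 v) := by
  rw [ProbabilityTheory.gaussianPDFReal_def]
  fun_prop

theorem hasDerivAt_cdf_gaussianReal {v : NNReal} (hv : v ≠ 0) (x : ℝ) :
    HasDerivAt (ProbabilityTheory.cdf (ProbabilityTheory.gaussianReal 0 v))
      (ProbabilityTheory.gaussianPDFReal 0 v x) x := by
  refine (hasDerivAt_integral_Iic (continuous_gaussianPDFReal v)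
    (ProbabilityTheory.integrable_gaussianPDFReal 0 v) x).congr_of_eventuallyEq
    (Eventually.of_forall fun y => ?_)
  rw [ProbabilityTheory.cdf_eq_real, measureReal_def,
    ProbabilityTheory.gaussianReal_apply_eq_integral 0 hv, ENNReal.toReal_ofReal]
  exact integral_nonneg fun t => ProbabilityTheory.gaussianPDFReal_nonneg 0 v t

/-- A density `g` of total mass less than `M` is carried into `M` times a centred Gaussian by a
differentiable monotone map defined on the whole line. -/
theorem exists_gaussian_transport {v : NNReal} (hv : v ≠ 0) {g : ℝ → ℝ} (hg : Continuous g)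
    (hg0 : ∀ x, 0 ≤ g x) (hi : Integrable g) {M : ℝ} (hM : ∫ x, g x < M) :
    ∃ T : ℝ → ℝ, ∀ x,
      HasDerivAt T (g x / (M * ProbabilityTheory.gaussianPDFReal 0 v (T x))) x := by
  set φ := ProbabilityTheory.gaussianPDFReal 0 v with hφ
  set Φ : ℝ → ℝ := fun x => ProbabilityTheory.cdf (ProbabilityTheory.gaussianReal 0 v) x with hΦ
  have hφpos : ∀ x, 0 < φ x := fun x => ProbabilityTheory.gaussianPDFReal_pos 0 v x hv
  have hΦd : ∀ x, HasDerivAt Φ (φ x) x := hasDerivAt_cdf_gaussianReal hv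
  have hΦc : Continuous Φ := continuous_iff_continuousAt.2 fun x => (hΦd x).continuousAt
  have hemb : IsOpenEmbedding Φ := by
    refine .of_continuous_injective_isOpenMap hΦc
      (strictMono_of_hasDerivAt_pos hΦd hφpos).injective
      (isOpenMap_of_hasStrictDerivAt (f' := φ) (fun x => ?_) fun x => (hφpos x).ne')
    exact hasStrictDerivAt_of_hasDerivAt_of_continuousAt (Eventually.of_forall hΦd)
      (continuous_gaussianPDFReal v).continuousAt
  have hm0 : 0 ≤ ∫ x, g x := integral_nonneg hg0
  have hMpos : 0 < M := hm0.trans_lt hM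
  set G : ℝ → ℝ := fun x => ((M - ∫ y, g y) / 2 + ∫ t in Set.Iic x, g t) / M with hG
  have hGd : ∀ x, HasDerivAt G (g x / M) x := fun x =>
    ((hasDerivAt_integral_Iic hg hi x).const_add _).div_const M
  have hGmem : ∀ x, G x ∈ Set.range Φ := by
    intro x
    have h1 : 0 ≤ ∫ t in Set.Iic x, g t := integral_nonneg hg0
    have h2 : ∫ t in Set.Iic x, g t ≤ ∫ t, g t :=
      setIntegral_le_integral hi (Eventually.of_forall hg0)
    have h3 : 0 < G x := by simp only [hG]; apply div_pos _ hMpos; linarith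
    have h4 : G x < 1 := by simp only [hG]; rw [div_lt_one hMpos]; linarith
    exact mem_range_of_exists_le_of_exists_ge hΦc
      (((ProbabilityTheory.tendsto_cdf_atBot _).eventually_lt_const h3).exists.imp
        fun _ h => h.le)
      (((ProbabilityTheory.tendsto_cdf_atTop _).eventually_const_lt h4).exists.imp
        fun _ h => h.le)
  set e := hemb.toOpenPartialHomeomorph Φ with he
  refine ⟨fun x => e.symm (G x), fun x => ?_⟩
  have hx : G x ∈ e.target := by
    rw [he, IsOpenEmbedding.toOpenPartialHomeomorph_target]
    exact hGmem x
  have hs := e.hasDerivAt_symm hx (hφpos (e.symm (G x))).ne' (hΦd _)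
  have := hs.comp x (hGd x)
  refine this.congr_deriv ?_
  rw [inv_mul_eq_div, div_div]

theorem log_gaussianPDFReal {K : ℝ} (hK : 0 < K) (t : ℝ) :
    log (ProbabilityTheory.gaussianPDFReal 0 (K⁻¹).toNNReal t) =
      log (K / (2 * π)) / 2 - K * t ^ 2 / 2 := by
  have hc : ((K⁻¹).toNNReal : ℝ) = K⁻¹ := Real.coe_toNNReal _ (inv_nonneg.2 hK.le)
  rw [ProbabilityTheory.gaussianPDFReal, hc, log_mul (by positivity) (exp_ne_zero _), log_exp,
    log_inv, log_sqrt (by positivity), log_div hK.ne' (by positivity),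
    log_mul (by positivity) (by positivity), log_inv]
  field_simp
  ring

theorem log_sobolev_real_of_lt {K M : ℝ} (hK : 0 < K) {f : ℝ → ℝ} (hf : ContDiff ℝ 1 f)
    (hfs : HasCompactSupport f) (hM : ∫ x, f x ^ 2 < M) :
    ∫ x, f x ^ 2 * log (f x ^ 2) ≤ 2 / K * (∫ x, deriv f x ^ 2) +
      (log M + log (K / (2 * π)) / 2 - 1) * ∫ x, f x ^ 2 := by
  have hc : Continuous f := hf.continuous
  have hdc : Continuous (deriv f) := hf.continuous_deriv le_rfl
  have hds : HasCompactSupport (deriv f) := hfs.deriv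
  have hv : (K⁻¹).toNNReal ≠ 0 := by simpa using hK
  have hMpos : 0 < M := (integral_nonneg fun x => sq_nonneg (f x)).trans_lt hM
  have compact_of_zero : ∀ {u : ℝ → ℝ}, Continuous u → (∀ x, f x = 0 → u x = 0) →
      Integrable u := fun hu h0 => hu.integrable_of_hasCompactSupport
        (hfs.mono' fun x hx => subset_tsupport f fun h => hx (h0 x h))
  have hi : Integrable fun x => f x ^ 2 := compact_of_zero (by fun_prop) (by simp +contextual)
  obtain ⟨T, hT⟩ := exists_gaussian_transport hv (hc.pow 2) (fun x => sq_nonneg (f x)) hi hM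
  set φ := ProbabilityTheory.gaussianPDFReal 0 (K⁻¹).toNNReal with hφ
  have hφpos : ∀ x, 0 < φ x := fun x => ProbabilityTheory.gaussianPDFReal_pos 0 _ x hv
  have hTc : Continuous T := continuous_iff_continuousAt.2 fun x => (hT x).continuousAt
  set T' : ℝ → ℝ := fun x => f x ^ 2 / (M * φ (T x)) with hT'
  have hT'c : Continuous T' := (hc.pow 2).div
    (continuous_const.mul ((continuous_gaussianPDFReal _).comp hTc))
    fun x => (mul_pos hMpos (hφpos _)).ne'
  have hfd : ∀ x, HasDerivAt (fun y => f y ^ 2) (2 * f x * deriv f x) x := fun x => by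
    simpa using ((hf.differentiable one_ne_zero x).hasDerivAt).fun_pow 2
  have hparts : ∫ x, f x ^ 2 * T' x = -∫ x, 2 * f x * deriv f x * T x :=
    integral_mul_deriv_eq_deriv_mul_of_integrable (fun x _ => hfd x) (fun x _ => hT x)
      (compact_of_zero (by fun_prop) (by simp +contextual))
      (compact_of_zero (by fun_prop) (by simp +contextual))
      (compact_of_zero (by fun_prop) (by simp +contextual))
  have hpt : ∀ x, f x ^ 2 * log (f x ^ 2) ≤ 2 / K * deriv f x ^ 2 +
      (log M + log (K / (2 * π)) / 2 - 1) * f x ^ 2 +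
      (f x ^ 2 * T' x + 2 * f x * deriv f x * T x) := by
    intro x
    have hsq : 0 ≤ 2 / K * deriv f x ^ 2 + K / 2 * T x ^ 2 * f x ^ 2 +
        2 * f x * deriv f x * T x := by
      have : 2 / K * deriv f x ^ 2 + K / 2 * T x ^ 2 * f x ^ 2 + 2 * f x * deriv f x * T x =
          (2 * deriv f x + K * T x * f x) ^ 2 / (2 * K) := by
        field_simp
        ring
      rw [this]
      positivity
    have hlog : f x ^ 2 * log (f x ^ 2) ≤ f x ^ 2 *
        (log M + (log (K / (2 * π)) / 2 - K * T x ^ 2 / 2) + (T' x - 1)) := by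
      rcases (sq_nonneg (f x)).eq_or_lt with h0 | hpos
      · simp [← h0]
      · have hT'pos : 0 < T' x := div_pos hpos (mul_pos hMpos (hφpos _))
        have hfac : f x ^ 2 = M * φ (T x) * T' x :=
          (mul_div_cancel₀ _ (mul_pos hMpos (hφpos _)).ne').symm
        refine mul_le_mul_of_nonneg_left ?_ hpos.le
        rw [hfac, log_mul (mul_pos hMpos (hφpos _)).ne' hT'pos.ne',
          log_mul hMpos.ne' (hφpos _).ne', hφ, log_gaussianPDFReal hK]
        gcongr
        exact log_le_sub_one_of_pos hT'pos
    linarith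
  have i1 : Integrable fun x => f x ^ 2 * log (f x ^ 2) :=
    compact_of_zero (continuous_mul_log.comp (hc.pow 2)) (by simp +contextual)
  have i2 : Integrable fun x => deriv f x ^ 2 :=
    (hdc.pow 2).integrable_of_hasCompactSupport (hasCompactSupport_sq hds)
  have i3 : Integrable fun x => f x ^ 2 * T' x :=
    compact_of_zero (by fun_prop) (by simp +contextual)
  have i4 : Integrable fun x => 2 * f x * deriv f x * T x :=
    compact_of_zero (by fun_prop) (by simp +contextual)
  have i5 : Integrable fun x => 2 / K * deriv f x ^ 2 +
      (log M + log (K / (2 * π)) / 2 - 1) * f x ^ 2 := (i2.const_mul _).add (hi.const_mul _)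
  have i6 : Integrable fun x => f x ^ 2 * T' x + 2 * f x * deriv f x * T x := i3.add i4
  have := integral_mono i1 (i5.add i6) hpt
  simp only [Pi.add_apply] at this
  rw [integral_add i5 i6, integral_add i3 i4,
    integral_add (i2.const_mul _) (hi.const_mul _), integral_const_mul, integral_const_mul,
    hparts] at this
  linarith

theorem log_sobolev_real {K : ℝ} (hK : 0 < K) {f : ℝ → ℝ} (hf : ContDiff ℝ 1 f)
    (hfs : HasCompactSupport f) :
    ∫ x, f x ^ 2 * log (f x ^ 2) ≤ 2 / K * (∫ x, deriv f x ^ 2) +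
      (log (K / (2 * π)) / 2 - 1) * (∫ x, f x ^ 2) +
        (∫ x, f x ^ 2) * log (∫ x, f x ^ 2) := by
  have hfi : Integrable fun x => f x ^ 2 := (hf.continuous.pow 2).integrable_of_hasCompactSupport
    (hasCompactSupport_sq hfs)
  rcases (integral_nonneg fun x => sq_nonneg (f x) : 0 ≤ ∫ x, f x ^ 2).eq_or_lt with h0 | hpos
  · have hz : ∀ x, f x = 0 := by
      by_contra! hne
      obtain ⟨x, hx⟩ := hne
      have := (hf.continuous.pow 2).integral_pos_of_hasCompactSupport_nonneg_nonzero (μ := volume)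
        (hasCompactSupport_sq hfs) (fun y => sq_nonneg (f y))
        (pow_ne_zero 2 hx)
      exact this.ne h0
    have : f = 0 := funext hz
    simp [this]
  · have hlim : Tendsto (fun M => 2 / K * (∫ x, deriv f x ^ 2) +
        (log M + log (K / (2 * π)) / 2 - 1) * ∫ x, f x ^ 2) (𝓝[>] (∫ x, f x ^ 2))
        (𝓝 (2 / K * (∫ x, deriv f x ^ 2) +
        (log (∫ x, f x ^ 2) + log (K / (2 * π)) / 2 - 1) * ∫ x, f x ^ 2)) := by
      refine tendsto_nhdsWithin_of_tendsto_nhds ?_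
      exact ((((continuousAt_log hpos.ne').add_const _).sub_const _).mul_const _).const_add _
    have := ge_of_tendsto hlim
      (eventually_mem_nhdsWithin.mono fun M hM => log_sobolev_real_of_lt hK hf hfs hM)
    linarith

section Product

variable {X Y : Type*} [TopologicalSpace X] [TopologicalSpace Y]

theorem hasCompactSupport_slice_left [T2Space X] [T2Space Y] {f : X × Y → ℝ}
    (hf : HasCompactSupport f) (y : Y) : HasCompactSupport fun x => f (x, y) :=
  HasCompactSupport.intro (hf.isCompact.image continuous_fst) fun x hx =>
    image_eq_zero_of_notMem_tsupport fun h => hx ⟨(x, y), h, rfl⟩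

theorem hasCompactSupport_marginal [T2Space Y] [MeasurableSpace X] {μ : Measure X}
    {f : X × Y → ℝ}
    (hf : HasCompactSupport f) : HasCompactSupport fun y => ∫ x, f (x, y) ∂μ :=
  HasCompactSupport.intro (hf.isCompact.image continuous_snd) fun y hy => by
    have : ∀ x, f (x, y) = 0 := fun x =>
      image_eq_zero_of_notMem_tsupport fun h => hy ⟨(x, y), h, rfl⟩
    simp [this]

theorem continuous_marginal [T2Space X] [LocallyCompactSpace Y] [FirstCountableTopology Y]
    [SecondCountableTopology X] [MeasurableSpace X] [BorelSpace X]
    {μ : Measure X} [IsLocallyFiniteMeasure μ] {f : X × Y → ℝ} (hc : Continuous f)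
    (hf : HasCompactSupport f) : Continuous fun y => ∫ x, f (x, y) ∂μ := by
  have hK := hf.isCompact.image continuous_fst
  have := continuous_parametric_integral_of_continuous (μ := μ)
    (f := fun (y : Y) (x : X) => f (x, y)) (by fun_prop) hK
  refine this.congr fun y => setIntegral_eq_integral_of_forall_compl_eq_zero fun x hx => ?_
  exact image_eq_zero_of_notMem_tsupport fun h => hx ⟨(x, y), h, rfl⟩

variable [LocallyCompactSpace Y] [T2Space X] [T2Space Y]
  [SecondCountableTopology X] [SecondCountableTopology Y]
  [MeasurableSpace X] [MeasurableSpace Y] [BorelSpace X] [BorelSpace Y]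
  {μ : Measure X} {ν : Measure Y} [IsLocallyFiniteMeasure μ] [IsLocallyFiniteMeasure ν]

theorem integrable_marginal {f : X × Y → ℝ} (hc : Continuous f) (hf : HasCompactSupport f) :
    Integrable (fun y => ∫ x, f (x, y) ∂μ) ν :=
  (continuous_marginal hc hf).integrable_of_hasCompactSupport (hasCompactSupport_marginal hf)

theorem integrable_marginal_mul_log {f : X × Y → ℝ} (hc : Continuous f)
    (hf : HasCompactSupport f) :
    Integrable (fun y => (∫ x, f (x, y) ∂μ) * log (∫ x, f (x, y) ∂μ)) ν :=
  (continuous_mul_log.comp (continuous_marginal hc hf)).integrable_of_hasCompactSupport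
    ((hasCompactSupport_marginal (μ := μ) hf).comp_left (g := fun t : ℝ => t * log t) (by simp))

variable [LocallyCompactSpace X]

theorem integrable_mul_log_marginal {p : X × Y → ℝ} (hc : Continuous p)
    (hs : HasCompactSupport p) (hp : ∀ z, 0 ≤ p z) :
    Integrable (fun z => p z * log (∫ x, p (x, z.2) ∂μ)) (μ.prod ν) := by
  have hGc := continuous_marginal (μ := μ) hc hs
  rw [integrable_prod_iff']
  · refine ⟨Eventually.of_forall fun y => ?_, ?_⟩
    · have hy : Integrable (fun x => p (x, y)) μ :=
        (hc.comp (Continuous.prodMk_left y)).integrable_of_hasCompactSupport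
          (hasCompactSupport_slice_left hs y)
      exact hy.mul_const (log (∫ x, p (x, y) ∂μ))
    · refine (integrable_marginal_mul_log (μ := μ) (ν := ν) hc hs).norm.congr
        (Eventually.of_forall fun y => ?_)
      simp only [norm_mul, integral_mul_const]
      congr 1
      rw [norm_of_nonneg (integral_nonneg fun x => hp _)]
      exact integral_congr_ae (Eventually.of_forall fun x => (norm_of_nonneg (hp _)).symm)
  · exact (hc.measurable.mul
      (measurable_log.comp (hGc.measurable.comp measurable_snd))).aestronglyMeasurable

theorem integral_mul_log_marginal {p : X × Y → ℝ} (hc : Continuous p)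
    (hs : HasCompactSupport p) (hp : ∀ z, 0 ≤ p z) :
    ∫ z, p z * log (∫ x, p (x, z.2) ∂μ) ∂(μ.prod ν) =
      ∫ y, (∫ x, p (x, y) ∂μ) * log (∫ x, p (x, y) ∂μ) ∂ν := by
  rw [integral_prod_symm _ (integrable_mul_log_marginal hc hs hp)]
  simp only [integral_mul_const]

theorem integrable_mul_log_marginal_right {p : X × Y → ℝ} (hc : Continuous p)
    (hs : HasCompactSupport p) (hp : ∀ z, 0 ≤ p z) :
    Integrable (fun z => p z * log (∫ y, p (z.1, y) ∂ν)) (μ.prod ν) :=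
  (integrable_mul_log_marginal (μ := ν) (ν := μ) (hc.comp continuous_swap)
    (hs.comp_homeomorph (Homeomorph.prodComm Y X)) fun _ => hp _).swap

theorem integral_mul_log_marginal_right {p : X × Y → ℝ} (hc : Continuous p)
    (hs : HasCompactSupport p) (hp : ∀ z, 0 ≤ p z) :
    ∫ z, p z * log (∫ y, p (z.1, y) ∂ν) ∂(μ.prod ν) =
      ∫ x, (∫ y, p (x, y) ∂ν) * log (∫ y, p (x, y) ∂ν) ∂μ := by
  rw [integral_prod _ (integrable_mul_log_marginal_right hc hs hp)]
  simp only [integral_mul_const]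

/-- Nonnegativity of mutual information, for a density that need not be normalized. -/
theorem integral_marginal_mul_log_add_le [μ.IsOpenPosMeasure] [ν.IsOpenPosMeasure]
    {p : X × Y → ℝ} (hc : Continuous p) (hs : HasCompactSupport p) (hp : ∀ z, 0 ≤ p z) :
    (∫ y, (∫ x, p (x, y) ∂μ) * log (∫ x, p (x, y) ∂μ) ∂ν) +
        ∫ x, (∫ y, p (x, y) ∂ν) * log (∫ y, p (x, y) ∂ν) ∂μ ≤
      (∫ z, p z * log (p z) ∂(μ.prod ν)) +
        (∫ z, p z ∂(μ.prod ν)) * log (∫ z, p z ∂(μ.prod ν)) := by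
  have hsw : HasCompactSupport (p ∘ Prod.swap) := hs.comp_homeomorph (Homeomorph.prodComm Y X)
  have hcw : Continuous (p ∘ Prod.swap) := hc.comp continuous_swap
  have hi : Integrable p (μ.prod ν) := hc.integrable_of_hasCompactSupport hs
  by_cases h0 : ∀ z, p z = 0
  · simp [h0]
  set m := ∫ z, p z ∂(μ.prod ν) with hm
  push Not at h0
  obtain ⟨z₀, hz₀⟩ := h0
  have hmpos : 0 < m := hc.integral_pos_of_hasCompactSupport_nonneg_nonzero hs hp hz₀
  set G : Y → ℝ := fun y => ∫ x, p (x, y) ∂μ with hG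
  set N : X → ℝ := fun x => ∫ y, p (x, y) ∂ν with hN
  have hG0 : ∀ y, 0 ≤ G y := fun y => integral_nonneg fun x => hp _
  have hN0 : ∀ x, 0 ≤ N x := fun x => integral_nonneg fun y => hp _
  have hGint : ∫ y, G y ∂ν = m := (integral_prod_symm p hi).symm
  have hNint : ∫ x, N x ∂μ = m := (integral_prod p hi).symm
  have hGi : Integrable G ν := integrable_marginal hc hs
  have hNi : Integrable N μ := integrable_marginal (f := p ∘ Prod.swap) hcw hsw
  have hpt : ∀ z : X × Y, p z - N z.1 * G z.2 / m ≤
      p z * log (p z) + p z * log m - p z * log (G z.2) - p z * log (N z.1) := by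
    rintro ⟨x, y⟩
    rcases (hp (x, y)).eq_or_lt with h | h
    · rw [← h]
      have := div_nonneg (mul_nonneg (hN0 x) (hG0 y)) hmpos.le
      simp only [zero_mul]
      linarith
    · have hGp : 0 < G y :=
        (hc.comp (Continuous.prodMk_left y)).integral_pos_of_hasCompactSupport_nonneg_nonzero
          (hasCompactSupport_slice_left hs y) (fun x => hp _) h.ne'
      have hNp : 0 < N x :=
        (hc.comp (Continuous.prodMk_right x)).integral_pos_of_hasCompactSupport_nonneg_nonzero
          (hasCompactSupport_slice_left hsw x) (fun y => hp _) h.ne'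
      have hl := one_sub_inv_le_log_of_pos (show 0 < p (x, y) * m / (G y * N x) by positivity)
      rw [log_div (by positivity) (by positivity), log_mul h.ne' hmpos.ne',
        log_mul hGp.ne' hNp.ne'] at hl
      have := mul_le_mul_of_nonneg_left hl h.le
      have he : p (x, y) * (1 - (p (x, y) * m / (G y * N x))⁻¹) =
          p (x, y) - N x * G y / m := by
        field_simp
      rw [he] at this
      simp only
      linarith
  have i1 : Integrable (fun z => p z * log (p z)) (μ.prod ν) :=
    (continuous_mul_log.comp hc).integrable_of_hasCompactSupport
      (hs.comp_left (g := fun t : ℝ => t * log t) (by simp))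
  have i2 : Integrable (fun z => p z * log m) (μ.prod ν) := hi.mul_const _
  have i3 : Integrable (fun z => p z * log (G z.2)) (μ.prod ν) :=
    integrable_mul_log_marginal hc hs hp
  have i4 : Integrable (fun z => p z * log (N z.1)) (μ.prod ν) :=
    integrable_mul_log_marginal_right hc hs hp
  have i5 : Integrable (fun z : X × Y => N z.1 * G z.2 / m) (μ.prod ν) :=
    (hNi.mul_prod hGi).div_const m
  have e3 : ∫ z, p z * log (G z.2) ∂(μ.prod ν) = ∫ y, G y * log (G y) ∂ν :=
    integral_mul_log_marginal hc hs hp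
  have e4 : ∫ z, p z * log (N z.1) ∂(μ.prod ν) = ∫ x, N x * log (N x) ∂μ :=
    integral_mul_log_marginal_right hc hs hp
  have i12 : Integrable (fun z => p z * log (p z) + p z * log m) (μ.prod ν) := i1.add i2
  have i123 : Integrable (fun z => p z * log (p z) + p z * log m - p z * log (G z.2))
    (μ.prod ν) := i12.sub i3
  have := integral_mono (hi.sub i5) (i123.sub i4) hpt
  simp only [Pi.sub_apply] at this
  rw [integral_sub hi i5, integral_sub i123 i4, integral_sub i12 i3, integral_add i1 i2, e3, e4,
    integral_mul_const, integral_div, integral_prod_mul, hGint, hNint,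
    mul_div_cancel_right₀ _ hmpos.ne', ← hm] at this
  linarith

/-- Tensorization of logarithmic Sobolev inequalities: `p` is the density, `D₁` and `D₂` the two
parts of its energy. -/
theorem log_sobolev_prod [μ.IsOpenPosMeasure] [ν.IsOpenPosMeasure] {p D₁ D₂ : X × Y → ℝ}
    (hc : Continuous p) (hs : HasCompactSupport p) (hp : ∀ z, 0 ≤ p z)
    (hc₁ : Continuous D₁) (hs₁ : HasCompactSupport D₁)
    (hc₂ : Continuous D₂) (hs₂ : HasCompactSupport D₂) {c a b : ℝ}
    (h₁ : ∀ y, ∫ x, p (x, y) * log (p (x, y)) ∂μ ≤ c * (∫ x, D₁ (x, y) ∂μ) +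
      a * (∫ x, p (x, y) ∂μ) + (∫ x, p (x, y) ∂μ) * log (∫ x, p (x, y) ∂μ))
    (h₂ : ∀ x, ∫ y, p (x, y) * log (p (x, y)) ∂ν ≤ c * (∫ y, D₂ (x, y) ∂ν) +
      b * (∫ y, p (x, y) ∂ν) + (∫ y, p (x, y) ∂ν) * log (∫ y, p (x, y) ∂ν)) :
    ∫ z, p z * log (p z) ∂(μ.prod ν) ≤ c * (∫ z, (D₁ z + D₂ z) ∂(μ.prod ν)) +
      (a + b) * (∫ z, p z ∂(μ.prod ν)) +
        (∫ z, p z ∂(μ.prod ν)) * log (∫ z, p z ∂(μ.prod ν)) := by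
  have swap_supp : ∀ {u : X × Y → ℝ}, HasCompactSupport u → HasCompactSupport (u ∘ Prod.swap) :=
    fun hu => hu.comp_homeomorph (Homeomorph.prodComm Y X)
  have hcl : Continuous fun z => p z * log (p z) := continuous_mul_log.comp hc
  have hsl : HasCompactSupport fun z => p z * log (p z) :=
    hs.comp_left (g := fun t : ℝ => t * log t) (by simp)
  have hi := hc.integrable_of_hasCompactSupport hs (μ := μ.prod ν)
  have hi₁ := hc₁.integrable_of_hasCompactSupport hs₁ (μ := μ.prod ν)
  have hi₂ := hc₂.integrable_of_hasCompactSupport hs₂ (μ := μ.prod ν)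
  have hil := hcl.integrable_of_hasCompactSupport hsl (μ := μ.prod ν)
  have key₁ : ∫ z, p z * log (p z) ∂(μ.prod ν) ≤ c * (∫ z, D₁ z ∂(μ.prod ν)) +
      a * (∫ z, p z ∂(μ.prod ν)) +
        ∫ y, (∫ x, p (x, y) ∂μ) * log (∫ x, p (x, y) ∂μ) ∂ν := by
    rw [integral_prod_symm _ hil, integral_prod_symm _ hi₁, integral_prod_symm _ hi,
      ← integral_const_mul, ← integral_const_mul]
    have j₁ := (integrable_marginal (μ := μ) (ν := ν) hc₁ hs₁).const_mul c
    have j₂ := (integrable_marginal (μ := μ) (ν := ν) hc hs).const_mul a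
    have j₃ := integrable_marginal_mul_log (μ := μ) (ν := ν) hc hs
    rw [← integral_add j₁ j₂, ← integral_add (j₁.fun_add j₂) j₃]
    exact integral_mono (integrable_marginal hcl hsl) ((j₁.fun_add j₂).add j₃) h₁
  have key₂ : ∫ z, p z * log (p z) ∂(μ.prod ν) ≤ c * (∫ z, D₂ z ∂(μ.prod ν)) +
      b * (∫ z, p z ∂(μ.prod ν)) +
        ∫ x, (∫ y, p (x, y) ∂ν) * log (∫ y, p (x, y) ∂ν) ∂μ := by
    rw [integral_prod _ hil, integral_prod _ hi₂, integral_prod _ hi,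
      ← integral_const_mul, ← integral_const_mul]
    have j₁ := (integrable_marginal (μ := ν) (ν := μ) (hc₂.comp continuous_swap)
      (swap_supp hs₂)).const_mul c
    have j₂ := (integrable_marginal (μ := ν) (ν := μ) (hc.comp continuous_swap)
      (swap_supp hs)).const_mul b
    have j₃ := integrable_marginal_mul_log (μ := ν) (ν := μ) (hc.comp continuous_swap)
      (swap_supp hs)
    have j₄ := integrable_marginal (μ := ν) (ν := μ) (hcl.comp continuous_swap) (swap_supp hsl)
    simp only [Function.comp_apply, Prod.swap_prod_mk] at j₁ j₂ j₃ j₄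
    rw [← integral_add j₁ j₂, ← integral_add (j₁.fun_add j₂) j₃]
    exact integral_mono j₄ ((j₁.fun_add j₂).add j₃) h₂
  have := integral_marginal_mul_log_add_le (μ := μ) (ν := ν) hc hs hp
  rw [integral_add hi₁ hi₂]
  linarith

end Product

theorem integral_fin_succ {n : ℕ} (u : (Fin (n + 1) → ℝ) → ℝ) :
    ∫ x, u x = ∫ z : ℝ × (Fin n → ℝ), u (Fin.cons z.1 z.2) := by
  rw [← (volume_preserving_piFinSuccAbove (fun _ : Fin (n + 1) => ℝ) 0).symm.integral_comp']
  refine integral_congr_ae (Eventually.of_forall fun z => congrArg u ?_)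
  simp [MeasurableEquiv.piFinSuccAbove, Fin.insertNthEquiv]

theorem contDiff_finCons {n : ℕ} :
    ContDiff ℝ 1 fun z : ℝ × (Fin n → ℝ) => (Fin.cons z.1 z.2 : Fin (n + 1) → ℝ) := by
  refine contDiff_pi.2 fun i => ?_
  refine Fin.cases ?_ (fun j => ?_) i
  · simpa using contDiff_fst
  · simp only [Fin.cons_succ]
    fun_prop

theorem finCons_zero_single {n : ℕ} (i : Fin n) :
    (Fin.cons 0 (Pi.single i 1) : Fin (n + 1) → ℝ) = Pi.single i.succ 1 := by
  ext j
  refine Fin.cases ?_ (fun k => ?_) j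
  · simp
  · simp [Pi.single_apply]

theorem finCons_add_smul {n : ℕ} (x t : ℝ) (y v : Fin n → ℝ) :
    (Fin.cons x (y + t • v) : Fin (n + 1) → ℝ) =
      Fin.cons x y + t • (Fin.cons 0 v : Fin (n + 1) → ℝ) := by
  ext j
  refine Fin.cases ?_ (fun k => ?_) j <;> simp

theorem hasDerivAt_finCons_left {n : ℕ} (x : ℝ) (y : Fin n → ℝ) :
    HasDerivAt (fun s => (Fin.cons s y : Fin (n + 1) → ℝ)) (Pi.single 0 1) x := by
  refine hasDerivAt_pi.2 fun j => ?_
  refine Fin.cases ?_ (fun k => ?_) j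
  · simpa using hasDerivAt_id' x
  · simpa using hasDerivAt_const x (y k)

theorem hasCompactSupport_comp_finCons {n : ℕ} {u : (Fin (n + 1) → ℝ) → ℝ}
    (hu : HasCompactSupport u) :
    HasCompactSupport fun z : ℝ × (Fin n → ℝ) => u (Fin.cons z.1 z.2) := by
  have hg : Continuous fun x : Fin (n + 1) → ℝ => (x 0, Fin.tail x) :=
    (continuous_apply 0).prodMk (continuous_pi fun i => continuous_apply i.succ)
  refine HasCompactSupport.intro (hu.isCompact.image hg) fun z hz => ?_
  exact image_eq_zero_of_notMem_tsupport fun h => hz ⟨_, h, by simp⟩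

theorem log_sobolev_pi {K : ℝ} (hK : 0 < K) (n : ℕ) {f : (Fin n → ℝ) → ℝ}
    (hf : ContDiff ℝ 1 f) (hfs : HasCompactSupport f) :
    ∫ x, f x ^ 2 * log (f x ^ 2) ≤
      2 / K * (∫ x, ∑ i, fderiv ℝ f x (Pi.single i 1) ^ 2) +
        n * (log (K / (2 * π)) / 2 - 1) * (∫ x, f x ^ 2) +
          (∫ x, f x ^ 2) * log (∫ x, f x ^ 2) := by
  induction n with
  | zero => simp [Measure.volume_pi_eq_dirac (0 : Fin 0 → ℝ)]
  | succ n ih =>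
    have hcons : Continuous fun z : ℝ × (Fin n → ℝ) => (Fin.cons z.1 z.2 : Fin (n + 1) → ℝ) :=
      contDiff_finCons.continuous
    have hpart : ∀ i, Continuous fun x => fderiv ℝ f x (Pi.single i 1) ^ 2 := fun i =>
      ((hf.continuous_fderiv one_ne_zero).clm_apply continuous_const).pow 2
    have hparts : ∀ i, HasCompactSupport fun x => fderiv ℝ f x (Pi.single i 1) ^ 2 := fun i =>
      hasCompactSupport_sq (hfs.fderiv_apply ℝ _)
    have hfd : Differentiable ℝ f := hf.differentiable one_ne_zero
    have hslice₁ : ∀ (x : ℝ) (y : Fin n → ℝ), deriv (fun s => f (Fin.cons s y)) x =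
        fderiv ℝ f (Fin.cons x y) (Pi.single 0 1) := fun x y =>
      ((hfd (Fin.cons x y)).hasFDerivAt.comp_hasDerivAt x (hasDerivAt_finCons_left x y)).deriv
    have hslice₂ : ∀ (x : ℝ) (y : Fin n → ℝ) (i : Fin n),
        fderiv ℝ (fun w => f (Fin.cons x w)) y (Pi.single i 1) =
          fderiv ℝ f (Fin.cons x y) (Pi.single i.succ 1) := by
      intro x y i
      have hd : DifferentiableAt ℝ (fun w => f (Fin.cons x w)) y :=
        (hfd _).comp y ((contDiff_finCons.comp
          (contDiff_const.prodMk contDiff_id)).differentiable one_ne_zero y)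
      rw [← hd.lineDeriv_eq_fderiv, ← (hfd _).lineDeriv_eq_fderiv, lineDeriv, lineDeriv,
        ← finCons_zero_single]
      simp only [finCons_add_smul]
    have key := log_sobolev_prod (μ := (volume : Measure ℝ)) (ν := (volume : Measure (Fin n → ℝ)))
      (p := fun z => f (Fin.cons z.1 z.2) ^ 2)
      (D₁ := fun z => fderiv ℝ f (Fin.cons z.1 z.2) (Pi.single 0 1) ^ 2)
      (D₂ := fun z => ∑ i : Fin n, fderiv ℝ f (Fin.cons z.1 z.2) (Pi.single i.succ 1) ^ 2)
      (c := 2 / K) (a := log (K / (2 * π)) / 2 - 1) (b := n * (log (K / (2 * π)) / 2 - 1))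
      ((hf.continuous.comp hcons).pow 2) (hasCompactSupport_sq (hasCompactSupport_comp_finCons hfs))
      (fun z => sq_nonneg _) ((hpart 0).comp hcons) (hasCompactSupport_comp_finCons (hparts 0))
      (continuous_finsetSum _ fun i _ => (hpart i.succ).comp hcons) ?_ ?_ ?_
    · rw [integral_fin_succ, integral_fin_succ, integral_fin_succ]
      simp only [Fin.sum_univ_succ]
      rw [Nat.cast_succ, add_comm (n : ℝ) 1, add_mul, one_mul]
      exact key
    · exact hasCompactSupport_comp_finCons
        (u := fun x => ∑ i : Fin n, fderiv ℝ f x (Pi.single i.succ 1) ^ 2)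
        (.intro hfs fun x hx => by simp [fderiv_of_notMem_tsupport ℝ hx])
    · intro y
      have := log_sobolev_real hK (f := fun s => f (Fin.cons s y))
        (hf.comp (contDiff_finCons.comp (contDiff_id.prodMk contDiff_const)))
        (hasCompactSupport_slice_left (hasCompactSupport_comp_finCons hfs) y)
      simpa only [hslice₁] using this
    · intro x
      have := ih (f := fun w => f (Fin.cons x w))
        (hf.comp (contDiff_finCons.comp (contDiff_const.prodMk contDiff_id)))
        (hasCompactSupport_slice_left ((hasCompactSupport_comp_finCons hfs).comp_homeomorph
          (Homeomorph.prodComm (Fin n → ℝ) ℝ)) x)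
      simpa only [hslice₂] using this

theorem norm_sq_eq_sum_apply_single {n : ℕ} (L : EuclideanSpace ℝ (Fin n) →L[ℝ] ℝ) :
    ‖L‖ ^ 2 = ∑ i, L (EuclideanSpace.single i 1) ^ 2 := by
  have h := (EuclideanSpace.basisFun (Fin n) ℝ).sum_sq_norm_inner_left
    ((InnerProductSpace.toDual ℝ (EuclideanSpace ℝ (Fin n))).symm L)
  rw [LinearIsometryEquiv.norm_map] at h
  rw [← h]
  simp [InnerProductSpace.toDual_symm_apply]

theorem log_sobolev_euclideanSpace {K : ℝ} (hK : 0 < K) {n : ℕ}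
    {f : EuclideanSpace ℝ (Fin n) → ℝ} (hf : ContDiff ℝ 1 f) (hfs : HasCompactSupport f) :
    ∫ x, f x ^ 2 * log (f x ^ 2) ≤
      2 / K * (∫ x, ∑ i, fderiv ℝ f x (EuclideanSpace.single i 1) ^ 2) +
        n * (log (K / (2 * π)) / 2 - 1) * (∫ x, f x ^ 2) +
          (∫ x, f x ^ 2) * log (∫ x, f x ^ 2) := by
  have hint : ∀ u : EuclideanSpace ℝ (Fin n) → ℝ,
      ∫ x, u x = ∫ y : Fin n → ℝ, u (WithLp.toLp 2 y) := fun u =>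
    ((PiLp.volume_preserving_toLp (Fin n)).integral_comp
      (MeasurableEquiv.toLp 2 (Fin n → ℝ)).measurableEmbedding u).symm
  let e := (EuclideanSpace.equiv (Fin n) ℝ).symm
  have he : ∀ y : Fin n → ℝ, WithLp.toLp 2 y = e y := fun y => rfl
  have hder : ∀ (y : Fin n → ℝ) (i : Fin n), fderiv ℝ (fun y => f (e y)) y (Pi.single i 1) =
      fderiv ℝ f (e y) (EuclideanSpace.single i 1) := by
    intro y i
    have := e.comp_right_fderiv (f := f) (x := y)
    simp only [Function.comp_def] at this
    rw [this]
    rfl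
  rw [hint, hint, hint]
  have := log_sobolev_pi hK n (f := fun y => f (e y)) (hf.comp e.contDiff)
    (hfs.comp_homeomorph e.toHomeomorph)
  simpa only [hder, he] using this

theorem integral_mul_lapl {n : ℕ} {V p : EuclideanSpace ℝ (Fin n) → ℝ} (hV : ContDiff ℝ 2 V)
    (hp : ContDiff ℝ 1 p) (hps : HasCompactSupport p) :
    ∫ x, (p x * lapl n V x + ∑ i, fderiv ℝ p x (EuclideanSpace.single i 1) *
      fderiv ℝ V x (EuclideanSpace.single i 1)) = 0 := by
  have hV' : ContDiff ℝ 1 (fderiv ℝ V) := hV.fderiv_right (by norm_num)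
  have hg : ∀ v, ContDiff ℝ 1 fun x => fderiv ℝ V x v := fun v => hV'.clm_apply contDiff_const
  have hgd : ∀ v x, fderiv ℝ (fun y => fderiv ℝ V y v) x v = fderiv ℝ (fderiv ℝ V) x v v := by
    intro v x
    rw [fderiv_clm_apply (hV'.differentiable one_ne_zero x) (by fun_prop)]
    simp
  have i₁ : ∀ v, Integrable fun x => fderiv ℝ p x v * fderiv ℝ V x v := fun v =>
    (((hp.continuous_fderiv one_ne_zero).clm_apply continuous_const).mul
      (hg v).continuous).integrable_of_hasCompactSupport (hps.fderiv_apply ℝ v).mul_right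
  have i₂ : ∀ v, Integrable fun x => p x * fderiv ℝ (fun y => fderiv ℝ V y v) x v := fun v =>
    (hp.continuous.mul (((hg v).continuous_fderiv one_ne_zero).clm_apply
      continuous_const)).integrable_of_hasCompactSupport hps.mul_right
  have i₃ : ∀ v, Integrable fun x => p x * fderiv ℝ V x v := fun v =>
    (hp.continuous.mul (hg v).continuous).integrable_of_hasCompactSupport hps.mul_right
  have hparts : ∀ v, ∫ x, (p x * fderiv ℝ (fun y => fderiv ℝ V y v) x v +
      fderiv ℝ p x v * fderiv ℝ V x v) = 0 := fun v => by
    rw [integral_add (i₂ v) (i₁ v), integral_mul_fderiv_eq_neg_fderiv_mul_of_integrable (i₁ v)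
      (i₂ v) (i₃ v) (fun x _ => hp.differentiable one_ne_zero x)
      (fun x _ => (hg v).differentiable one_ne_zero x), neg_add_cancel]
  have : ∀ x, p x * lapl n V x + ∑ i, fderiv ℝ p x (EuclideanSpace.single i 1) *
      fderiv ℝ V x (EuclideanSpace.single i 1) =
      ∑ i, (p x * fderiv ℝ (fun y => fderiv ℝ V y (EuclideanSpace.single i 1)) x
        (EuclideanSpace.single i 1) + fderiv ℝ p x (EuclideanSpace.single i 1) *
        fderiv ℝ V x (EuclideanSpace.single i 1)) := by
    intro x
    simp only [lapl, iteratedFDeriv_two_apply, hgd, Finset.sum_add_distrib, Finset.mul_sum]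
    simp
  simp only [this]
  rw [integral_finsetSum _ fun i _ => (i₂ _).fun_add (i₁ _)]
  simp [hparts]

/-- Substituting `f = h * exp (-V / 2)` into an energy density. -/
theorem sum_fderiv_mul_exp_sq {n : ℕ} {V h : EuclideanSpace ℝ (Fin n) → ℝ}
    (hV : Differentiable ℝ V) (hh : Differentiable ℝ h) (x : EuclideanSpace ℝ (Fin n)) :
    ∑ i, fderiv ℝ (fun y => h y * exp (-V y / 2)) x (EuclideanSpace.single i 1) ^ 2 =
      ‖fderiv ℝ h x‖ ^ 2 * exp (-V x) - h x ^ 2 * exp (-V x) * ‖fderiv ℝ V x‖ ^ 2 / 4 -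
        (∑ i, fderiv ℝ (fun y => h y ^ 2 * exp (-V y)) x (EuclideanSpace.single i 1) *
          fderiv ℝ V x (EuclideanSpace.single i 1)) / 2 := by
  have hV' := (hV x).hasFDerivAt
  have hh' := (hh x).hasFDerivAt
  have hexp : exp (-V x / 2) ^ 2 = exp (-V x) := by
    rw [← exp_nat_mul]
    congr 1
    push_cast
    ring
  have d₁ : ∀ v, fderiv ℝ (fun y => h y * exp (-V y / 2)) x v =
      (fderiv ℝ h x v - h x * fderiv ℝ V x v / 2) * exp (-V x / 2) := by
    intro v
    have := (hh'.fun_mul ((hV'.fun_neg.mul_const (2⁻¹ : ℝ)).exp)).fderiv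
    simp only [← div_eq_mul_inv] at this
    rw [this]
    simp
    ring
  have d₂ : ∀ v, fderiv ℝ (fun y => h y ^ 2 * exp (-V y)) x v =
      (2 * h x * fderiv ℝ h x v - h x ^ 2 * fderiv ℝ V x v) * exp (-V x) := by
    intro v
    have hsq : HasFDerivAt (fun y => h y ^ 2) ((2 * h x) • fderiv ℝ h x) x := by
      simpa using hh'.pow 2
    rw [(hsq.fun_mul hV'.fun_neg.exp).fderiv]
    simp
    ring
  simp only [d₁, d₂, norm_sq_eq_sum_apply_single, Finset.sum_mul, Finset.mul_sum,
    Finset.sum_div, ← Finset.sum_sub_distrib]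
  refine Finset.sum_congr rfl fun i _ => ?_
  rw [mul_pow, hexp]
  ring

theorem continuous_lapl {n : ℕ} {V : EuclideanSpace ℝ (Fin n) → ℝ} (hV : ContDiff ℝ 2 V) :
    Continuous (lapl n V) := by
  have hV' : ContDiff ℝ 1 (fderiv ℝ V) := hV.fderiv_right (by norm_num)
  have := hV'.continuous_fderiv one_ne_zero
  unfold lapl
  simp only [iteratedFDeriv_two_apply]
  fun_prop

/-- The inequality for the measure with density `exp (-V)`, before normalization. -/
theorem log_sobolev_exp_neg {n : ℕ} {V h : EuclideanSpace ℝ (Fin n) → ℝ} {K C : ℝ} (hK : 0 < K)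
    (hV : ContDiff ℝ 2 V) (hh : ContDiff ℝ 1 h) (hs : HasCompactSupport h)
    (hbound : ∀ᵐ x, V x - ‖fderiv ℝ V x‖ ^ 2 / (2 * K) + lapl n V x / K - n ≤ C) :
    ∫ x, h x ^ 2 * log (h x ^ 2) * exp (-V x) ≤
      2 / K * (∫ x, ‖fderiv ℝ h x‖ ^ 2 * exp (-V x)) +
        (n / 2 * log (K / (2 * π)) + C) * (∫ x, h x ^ 2 * exp (-V x)) +
          (∫ x, h x ^ 2 * exp (-V x)) * log (∫ x, h x ^ 2 * exp (-V x)) := by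
  have hVc : Continuous V := hV.continuous
  have hhc : Continuous h := hh.continuous
  have hVdc : Continuous (fderiv ℝ V) := hV.continuous_fderiv two_ne_zero
  have hhdc : Continuous (fderiv ℝ h) := hh.continuous_fderiv one_ne_zero
  have hLc := continuous_lapl hV
  have hV₁ : ContDiff ℝ 1 V := hV.of_le one_le_two
  have hf : ContDiff ℝ 1 fun x => h x * exp (-V x / 2) :=
    hh.mul (contDiff_exp.comp (hV₁.neg.div_const 2))
  have hp : ContDiff ℝ 1 fun x => h x ^ 2 * exp (-V x) :=
    (hh.pow 2).mul (contDiff_exp.comp hV₁.neg)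
  have hfs : HasCompactSupport fun x => h x * exp (-V x / 2) := hs.mul_right
  have hps : HasCompactSupport fun x => h x ^ 2 * exp (-V x) := (hasCompactSupport_sq hs).mul_right
  have hfp : ∀ x, (h x * exp (-V x / 2)) ^ 2 = h x ^ 2 * exp (-V x) := by
    intro x
    rw [mul_pow, ← exp_nat_mul]
    congr 2
    push_cast
    ring
  have hlog : ∀ x, h x ^ 2 * exp (-V x) * log (h x ^ 2 * exp (-V x)) =
      h x ^ 2 * log (h x ^ 2) * exp (-V x) - h x ^ 2 * exp (-V x) * V x := by
    intro x
    rcases eq_or_ne (h x) 0 with h0 | h0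
    · simp [h0]
    · rw [log_mul (pow_ne_zero 2 h0) (exp_ne_zero _), log_exp]
      ring
  have hsob := log_sobolev_euclideanSpace hK hf hfs
  simp only [hfp, sum_fderiv_mul_exp_sq (hV₁.differentiable one_ne_zero)
    (hh.differentiable one_ne_zero), hlog] at hsob
  let B : EuclideanSpace ℝ (Fin n) → ℝ := fun x =>
    ∑ i, fderiv ℝ (fun y => h y ^ 2 * exp (-V y)) x (EuclideanSpace.single i 1) *
      fderiv ℝ V x (EuclideanSpace.single i 1)
  have hdiv : ∫ x, (h x ^ 2 * exp (-V x) * lapl n V x + B x) = 0 := integral_mul_lapl hV hp hps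
  replace hsob : ∫ x, (h x ^ 2 * log (h x ^ 2) * exp (-V x) - h x ^ 2 * exp (-V x) * V x) ≤
      2 / K * (∫ x, (‖fderiv ℝ h x‖ ^ 2 * exp (-V x) -
        h x ^ 2 * exp (-V x) * ‖fderiv ℝ V x‖ ^ 2 / 4 - B x / 2)) +
      n * (log (K / (2 * π)) / 2 - 1) * (∫ x, h x ^ 2 * exp (-V x)) +
      (∫ x, h x ^ 2 * exp (-V x)) * log (∫ x, h x ^ 2 * exp (-V x)) := hsob
  have hBc : Continuous B := continuous_finsetSum _ fun i _ =>
    ((hp.continuous_fderiv one_ne_zero).clm_apply continuous_const).mul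
      (hVdc.clm_apply continuous_const)
  have hBz : ∀ x ∉ tsupport h, B x = 0 := by
    intro x hx
    have : x ∉ tsupport fun y => h y ^ 2 * exp (-V y) := fun hx' =>
      hx (closure_mono
      (fun y (hy : h y ^ 2 * exp (-V y) ≠ 0) (hy0 : h y = 0) => hy (by simp [hy0])) hx')
    simp [B, fderiv_of_notMem_tsupport ℝ this]
  have hz : ∀ x ∉ tsupport h, h x = 0 := fun x hx => image_eq_zero_of_notMem_tsupport hx
  have hdz : ∀ x ∉ tsupport h, fderiv ℝ h x = 0 := fun x hx => fderiv_of_notMem_tsupport ℝ hx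
  have int : ∀ {u : EuclideanSpace ℝ (Fin n) → ℝ}, Continuous u → (∀ x ∉ tsupport h, u x = 0) →
      Integrable u := fun hu h0 => hu.integrable_of_hasCompactSupport (.intro hs h0)
  have hentc : Continuous fun x => h x ^ 2 * log (h x ^ 2) :=
    continuous_mul_log.comp (hhc.pow 2)
  have i₁ : Integrable fun x => h x ^ 2 * log (h x ^ 2) * exp (-V x) :=
    int (by fun_prop) fun x hx => by simp [hz x hx]
  have i₂ : Integrable fun x => ‖fderiv ℝ h x‖ ^ 2 * exp (-V x) :=
    int (by fun_prop) fun x hx => by simp [hdz x hx]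
  have i₃ : Integrable fun x => h x ^ 2 * exp (-V x) :=
    int (by fun_prop) fun x hx => by simp [hz x hx]
  have i₄ : Integrable fun x => h x ^ 2 * log (h x ^ 2) * exp (-V x) -
      h x ^ 2 * exp (-V x) * V x :=
    int (by fun_prop) fun x hx => by simp [hz x hx]
  have i₅ : Integrable fun x => ‖fderiv ℝ h x‖ ^ 2 * exp (-V x) -
      h x ^ 2 * exp (-V x) * ‖fderiv ℝ V x‖ ^ 2 / 4 - B x / 2 :=
    int (by fun_prop) fun x hx => by simp [hz x hx, hdz x hx, hBz x hx]
  have i₆ : Integrable fun x => h x ^ 2 * exp (-V x) * lapl n V x + B x :=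
    int (by fun_prop) fun x hx => by simp [hz x hx, hBz x hx]
  have hle : ∫ x, (h x ^ 2 * log (h x ^ 2) * exp (-V x) -
      2 / K * (‖fderiv ℝ h x‖ ^ 2 * exp (-V x))) ≤
      ∫ x, ((h x ^ 2 * log (h x ^ 2) * exp (-V x) - h x ^ 2 * exp (-V x) * V x -
        2 / K * (‖fderiv ℝ h x‖ ^ 2 * exp (-V x) -
          h x ^ 2 * exp (-V x) * ‖fderiv ℝ V x‖ ^ 2 / 4 - B x / 2)) +
        ((C + n) * (h x ^ 2 * exp (-V x)) -
          K⁻¹ * (h x ^ 2 * exp (-V x) * lapl n V x + B x))) := by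
    refine integral_mono_ae (i₁.sub (i₂.const_mul _)) ((i₄.sub (i₅.const_mul _)).add
      ((i₃.const_mul _).sub (i₆.const_mul _))) (hbound.mono fun x hx => ?_)
    have := mul_le_mul_of_nonneg_left hx (show 0 ≤ h x ^ 2 * exp (-V x) by positivity)
    beta_reduce
    rw [← sub_nonneg] at this ⊢
    convert this using 1
    field_simp
    ring
  rw [integral_sub i₁ (i₂.const_mul _), integral_add (i₄.sub' (i₅.const_mul _))
      ((i₃.const_mul _).sub' (i₆.const_mul _)), integral_sub i₄ (i₅.const_mul _),
    integral_sub (i₃.const_mul _) (i₆.const_mul _), integral_const_mul, integral_const_mul,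
    integral_const_mul, integral_const_mul, hdiv] at hle
  linarith

/-- Generalized Gaussian logarithmic-Sobolev inequality in `ℝ^n`
(Euclidean case of Remark 4.2(c)). -/
theorem gaussian_log_sobolev_euclidean_general (n : ℕ) (hn : 2 ≤ n)
    (V : EuclideanSpace ℝ (Fin n) → ℝ) (hV : ContDiff ℝ 2 V) (K CV : ℝ) (hK : 0 < K)
    (hbound : ∀ᵐ x ∂(volume : Measure (EuclideanSpace ℝ (Fin n))),
      V x - ‖fderiv ℝ V x‖ ^ 2 / (2 * K) + lapl n V x / K - n ≤ CV)
    (hexp : Integrable fun x : EuclideanSpace ℝ (Fin n) => Real.exp (-V x))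
    (GV : ℝ) (hGV : GV = ∫ x : EuclideanSpace ℝ (Fin n), Real.exp (-V x))
    (γ : Measure (EuclideanSpace ℝ (Fin n)))
    (hγ : γ = volume.withDensity fun x => ENNReal.ofReal (GV⁻¹ * Real.exp (-V x)))
    (h : EuclideanSpace ℝ (Fin n) → ℝ) (hh : ContDiff ℝ (⊤ : ℕ∞) h)
    (hhsupp : HasCompactSupport h) (hnorm : ∫ x, (h x) ^ 2 ∂γ = 1) :
    ∫ x, (h x) ^ 2 * Real.log ((h x) ^ 2) ∂γ ≤
      (2 / K) * ∫ x, ‖fderiv ℝ h x‖ ^ 2 ∂γ +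
        Real.log (K ^ ((n : ℝ) / 2) * GV * Real.exp CV / (2 * Real.pi) ^ ((n : ℝ) / 2)) := by
  have hGpos : 0 < GV := hGV ▸ integral_exp_pos hexp
  have hγint : ∀ u : EuclideanSpace ℝ (Fin n) → ℝ,
      ∫ x, u x ∂γ = GV⁻¹ * ∫ x, u x * exp (-V x) := by
    intro u
    rw [hγ, integral_withDensity_eq_integral_toReal_smul, ← integral_const_mul]
    · refine integral_congr_ae (Eventually.of_forall fun x => ?_)
      simp only [smul_eq_mul]
      rw [ENNReal.toReal_ofReal (by positivity)]
      ring
    · have := hV.continuous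
      exact Measurable.ennreal_ofReal (by fun_prop)
    · exact Eventually.of_forall fun x => ENNReal.ofReal_lt_top
  have hmass : ∫ x, h x ^ 2 * exp (-V x) = GV := by
    rw [hγint, inv_mul_eq_one₀ hGpos.ne'] at hnorm
    exact hnorm.symm
  have key := log_sobolev_exp_neg hK hV (hh.of_le (by exact_mod_cast le_top)) hhsupp hbound
  rw [hmass] at key
  have hπ : (0 : ℝ) < 2 * π := by positivity
  have hlog : log (K ^ ((n : ℝ) / 2) * GV * exp CV / (2 * π) ^ ((n : ℝ) / 2)) =
      n / 2 * log (K / (2 * π)) + CV + log GV := by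
    rw [log_div (by positivity) (by positivity), log_mul (by positivity) (exp_ne_zero _),
      log_mul (by positivity) hGpos.ne', log_rpow hK, log_rpow hπ, log_exp,
      log_div hK.ne' hπ.ne']
    ring
  rw [hγint, hγint, hlog, inv_mul_le_iff₀ hGpos]
  refine key.trans_eq ?_
  field_simp
  ring
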